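/- For every positive integer N there exist a sequence of real numbers (ω_n)_{n≥1} and a sequence of smooth functions (u_n)_{n≥0} from ℝ² to ℝ such that: (i) u_0(τ,x) = cos τ · sin(N x); (ii) for every n ≥ 1, u_n is a finite linear combination of the functions (τ,x) ↦ cos((2j+1)τ)·sin(k x) with integers 0 ≤ j ≤ n and 1 ≤ k ≤ (2n+1)N; (iii) ∫₀^π u_n(0,x)·sin(N x) dx = 0 for every n ≥ 1; and (iv) for every n ≥ 1 and all (τ,x) ∈ ℝ × (0,π), N²·∂²_τ u_n(τ,x) − ∂²_x u_n(τ,x) + Σ_{k=1}^{n} ω_k · ∂²_τ u_{n−k}(τ,x) + (sin x)^{−2} · Σ_{i+j+k=n−1, i,j,k≥0} u_i(τ,x)·u_j(τ,x)·u_k(τ,x) = 0. -/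

import Mathlib

open Real Set Finset

/-- The mode `cos ((2j+1)τ) sin (kx)` attached to the index `(j, k)`. -/
noncomputable def trigMode (p : ℕ × ℕ) : ℝ → ℝ → ℝ :=
  fun τ x => Real.cos ((2 * p.1 + 1 : ℕ) * τ) * Real.sin ((p.2 : ℕ) * x)

/-- Trigonometric polynomials, encoded by their coefficients, as functions of `(τ, x)`. -/
noncomputable def trigEval : (ℕ × ℕ →₀ ℝ) →ₗ[ℝ] (ℝ → ℝ → ℝ) :=
  Finsupp.linearCombination ℝ trigMode

/-- Evaluation followed by multiplication with `sin² x`. -/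
noncomputable def sinSqEval : (ℕ × ℕ →₀ ℝ) →ₗ[ℝ] (ℝ → ℝ → ℝ) :=
  LinearMap.mulLeft ℝ (fun _ x => Real.sin x ^ 2) ∘ₗ trigEval

/-- The Fourier multiplier with symbol `w`. -/
noncomputable def trigMultiplier (w : ℕ × ℕ → ℝ) : (ℕ × ℕ →₀ ℝ) →ₗ[ℝ] (ℕ × ℕ →₀ ℝ) :=
  Finsupp.linearCombination ℝ fun p => Finsupp.single p (w p)

/-- The second time derivative on coefficients. -/
noncomputable def timeLaplacian : (ℕ × ℕ →₀ ℝ) →ₗ[ℝ] (ℕ × ℕ →₀ ℝ) :=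
  trigMultiplier fun p => -(2 * p.1 + 1 : ℝ) ^ 2

/-- The operator `N² ∂²_τ - ∂²_x` on coefficients. -/
noncomputable def waveOperator (N : ℕ) : (ℕ × ℕ →₀ ℝ) →ₗ[ℝ] (ℕ × ℕ →₀ ℝ) :=
  trigMultiplier fun p => (p.2 : ℝ) ^ 2 - (N : ℝ) ^ 2 * (2 * p.1 + 1) ^ 2

/-- The coefficient of `sin (N x)` at time `τ = 0`. -/
noncomputable def initialCoeff (N : ℕ) : (ℕ × ℕ →₀ ℝ) →ₗ[ℝ] ℝ :=
  Finsupp.linearCombination ℝ fun p => if p.2 = N then 1 else 0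

/-- Indices allowed at order `n`. -/
def orderBox (N n : ℕ) : Set (ℕ × ℕ) :=
  {p | p.1 ≤ n ∧ 1 ≤ p.2 ∧ p.2 ≤ (2 * n + 1) * N}

/-- Indices allowed at order `n`, without the highest spatial frequency. -/
def openBox (N n : ℕ) : Set (ℕ × ℕ) :=
  {p | p.1 ≤ n ∧ 1 ≤ p.2 ∧ p.2 < (2 * n + 1) * N}

/-- Nonresonant indices allowed at order `n`. -/
def nonresonantBox (N n : ℕ) : Set (ℕ × ℕ) :=
  {p | p ∈ orderBox N n ∧ p.2 ≠ (2 * p.1 + 1) * N}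

/-- The resonant mode `cos ((2j+1)τ) sin ((2j+1)Nx)`. -/
noncomputable def resonantMode (N j : ℕ) : ℕ × ℕ →₀ ℝ :=
  Finsupp.single (j, (2 * j + 1) * N) 1

theorem trigEval_single (p : ℕ × ℕ) (a : ℝ) :
    trigEval (Finsupp.single p a) = a • trigMode p := by
  simp [trigEval]

theorem trigEval_apply (c : ℕ × ℕ →₀ ℝ) (τ x : ℝ) :
    trigEval c τ x = ∑ p ∈ c.support,
      c p * (Real.cos ((2 * p.1 + 1 : ℕ) * τ) * Real.sin ((p.2 : ℕ) * x)) := by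
  simp [trigEval, Finsupp.linearCombination_apply, Finsupp.sum, Finset.sum_apply, trigMode]

theorem sinSqEval_apply (c : ℕ × ℕ →₀ ℝ) (τ x : ℝ) :
    sinSqEval c τ x = Real.sin x ^ 2 * trigEval c τ x := rfl

theorem trigMultiplier_apply (w : ℕ × ℕ → ℝ) (c : ℕ × ℕ →₀ ℝ) (p : ℕ × ℕ) :
    trigMultiplier w c p = w p * c p := by
  induction c using Finsupp.induction_linear with
  | zero => simp
  | add f g hf hg => simp [hf, hg, mul_add]
  | single q a =>
    simp only [trigMultiplier, Finsupp.linearCombination_single, Finsupp.smul_apply,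
      Finsupp.single_apply, smul_eq_mul]
    split_ifs with h
    · rw [h, mul_comm]
    · simp

theorem trigMultiplier_mem_supported (w : ℕ × ℕ → ℝ) {A : Set (ℕ × ℕ)} {c : ℕ × ℕ →₀ ℝ}
    (hc : c ∈ Finsupp.supported ℝ ℝ A) : trigMultiplier w c ∈ Finsupp.supported ℝ ℝ A := by
  rw [Finsupp.mem_supported'] at hc ⊢
  intro p hp
  rw [trigMultiplier_apply, hc p hp, mul_zero]

theorem trigEval_trigMultiplier (w : ℕ × ℕ → ℝ) (c : ℕ × ℕ →₀ ℝ) (τ x : ℝ) :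
    trigEval (trigMultiplier w c) τ x = ∑ p ∈ c.support,
      w p * (c p * (Real.cos ((2 * p.1 + 1 : ℕ) * τ) * Real.sin ((p.2 : ℕ) * x))) := by
  rw [trigEval, Finsupp.linearCombination_apply, Finsupp.sum_of_support_subset (s := c.support)]
  · simp [Finset.sum_apply, trigMode, trigMultiplier_apply, mul_assoc]
  · intro p
    simp only [Finsupp.mem_support_iff, trigMultiplier_apply]
    exact right_ne_zero_of_mul
  · simp

theorem contDiff_trigEval (c : ℕ × ℕ →₀ ℝ) :
    ContDiff ℝ (⊤ : ℕ∞) (Function.uncurry (trigEval c)) := by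
  have h : Function.uncurry (trigEval c) = fun q : ℝ × ℝ => ∑ p ∈ c.support,
      c p * (Real.cos ((2 * p.1 + 1 : ℕ) * q.1) * Real.sin ((p.2 : ℕ) * q.2)) := by
    ext ⟨τ, x⟩
    exact trigEval_apply c τ x
  rw [h]
  fun_prop

theorem deriv_deriv_trigEval_time (c : ℕ × ℕ →₀ ℝ) (τ x : ℝ) :
    deriv (deriv fun t => trigEval c t x) τ = trigEval (timeLaplacian c) τ x := by
  have h₁ : (deriv fun t => trigEval c t x) = fun t => ∑ p ∈ c.support,
      c p * (-Real.sin ((2 * p.1 + 1 : ℕ) * t) * (2 * p.1 + 1 : ℕ) * Real.sin ((p.2 : ℕ) * x)) := by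
    ext t
    simp only [trigEval_apply]
    refine (HasDerivAt.fun_sum fun p _ => ?_).deriv
    exact ((((hasDerivAt_id t).const_mul _).cos.mul_const _).const_mul _).congr_deriv
      (by simp)
  rw [h₁, timeLaplacian, trigEval_trigMultiplier]
  refine (HasDerivAt.fun_sum fun p _ => ?_).deriv
  exact ((((((hasDerivAt_id τ).const_mul _).sin.neg).mul_const _).mul_const _).const_mul
    _).congr_deriv (by simp; ring)

theorem deriv_deriv_trigEval_space (c : ℕ × ℕ →₀ ℝ) (τ x : ℝ) :
    deriv (deriv fun y => trigEval c τ y) x =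
      trigEval (trigMultiplier (fun p => -(p.2 : ℝ) ^ 2) c) τ x := by
  have h₁ : (deriv fun y => trigEval c τ y) = fun y => ∑ p ∈ c.support,
      c p * (Real.cos ((2 * p.1 + 1 : ℕ) * τ) * (Real.cos ((p.2 : ℕ) * y) * (p.2 : ℕ))) := by
    ext y
    simp only [trigEval_apply]
    refine (HasDerivAt.fun_sum fun p _ => ?_).deriv
    exact ((((hasDerivAt_id y).const_mul _).sin.const_mul _).const_mul _).congr_deriv
      (by simp)
  rw [h₁, trigEval_trigMultiplier]
  refine (HasDerivAt.fun_sum fun p _ => ?_).deriv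
  exact (((((hasDerivAt_id x).const_mul _).cos.mul_const _).const_mul _).const_mul
    _).congr_deriv (by simp; ring)

theorem trigEval_waveOperator (N : ℕ) (c : ℕ × ℕ →₀ ℝ) (τ x : ℝ) :
    trigEval (waveOperator N c) τ x = (N : ℝ) ^ 2 * deriv (deriv fun t => trigEval c t x) τ
      - deriv (deriv fun y => trigEval c τ y) x := by
  rw [deriv_deriv_trigEval_time, deriv_deriv_trigEval_space, waveOperator, timeLaplacian]
  simp only [trigEval_trigMultiplier, Finset.mul_sum, ← Finset.sum_sub_distrib]
  exact Finset.sum_congr rfl fun p _ => by ring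

theorem integral_cos_int_mul {z : ℤ} (hz : z ≠ 0) : ∫ x in (0:ℝ)..π, Real.cos (z * x) = 0 := by
  rw [intervalIntegral.integral_comp_mul_left _ (by exact_mod_cast hz)]
  simp

theorem integral_sin_mul_sin (k : ℕ) {N : ℕ} (hN : 0 < N) :
    ∫ x in (0:ℝ)..π, Real.sin (k * x) * Real.sin (N * x) = if k = N then π / 2 else 0 := by
  have h (x : ℝ) : Real.sin (k * x) * Real.sin (N * x) =
      (Real.cos (((k - N : ℤ) : ℝ) * x) - Real.cos (((k + N : ℤ) : ℝ) * x)) * (1 / 2) := by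
    push_cast
    rw [sub_mul (k : ℝ), add_mul (k : ℝ), Real.cos_sub, Real.cos_add]
    ring
  simp only [h]
  rw [intervalIntegral.integral_mul_const, intervalIntegral.integral_sub
    (by apply Continuous.intervalIntegrable; fun_prop)
    (by apply Continuous.intervalIntegrable; fun_prop),
    integral_cos_int_mul (z := k + N) (by omega)]
  split_ifs with hk
  · simp [hk, div_eq_mul_inv]
  · rw [integral_cos_int_mul (by omega)]; simp

theorem integral_trigEval_mul_sin {N : ℕ} (hN : 0 < N) (c : ℕ × ℕ →₀ ℝ) :
    ∫ x in (0:ℝ)..π, trigEval c 0 x * Real.sin (N * x) = π / 2 * initialCoeff N c := by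
  simp only [trigEval_apply, Finset.sum_mul]
  rw [intervalIntegral.integral_finsetSum
    (fun p _ => by apply Continuous.intervalIntegrable; fun_prop)]
  rw [initialCoeff, Finsupp.linearCombination_apply, Finsupp.sum, Finset.mul_sum]
  refine Finset.sum_congr rfl fun p _ => ?_
  simp only [mul_zero, Real.cos_zero, one_mul, mul_assoc]
  rw [intervalIntegral.integral_const_mul, integral_sin_mul_sin _ hN]
  split_ifs <;> simp [mul_comm]

theorem trigEval_of_mem_supported_orderBox {N n : ℕ} {c : ℕ × ℕ →₀ ℝ}
    (hc : c ∈ Finsupp.supported ℝ ℝ (orderBox N n)) (τ x : ℝ) :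
    trigEval c τ x = ∑ j ∈ Finset.range (n + 1), ∑ k ∈ Finset.Icc 1 ((2 * n + 1) * N),
      c (j, k) * Real.cos ((2 * j + 1 : ℕ) * τ) * Real.sin ((k : ℕ) * x) := by
  rw [trigEval_apply, ← Finset.sum_product']
  simp only [mul_assoc]
  refine Finset.sum_subset (fun p hp => ?_) (fun p _ hp => ?_)
  · obtain ⟨h₁, h₂, h₃⟩ := (Finsupp.mem_supported _ _).1 hc hp
    simp only [Finset.mem_product, Finset.mem_range, Finset.mem_Icc]
    exact ⟨by omega, h₂, h₃⟩
  · rw [Finsupp.notMem_support_iff.1 hp, zero_mul]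

theorem cos_mul_sin_int_mem {A : Set (ℕ × ℕ)} {w z : ℤ} {j : ℕ} (hw : w.natAbs = 2 * j + 1)
    (hz : z = 0 ∨ (j, z.natAbs) ∈ A) :
    (fun τ x => Real.cos (w * τ) * Real.sin (z * x)) ∈
      (Finsupp.supported ℝ ℝ A).map trigEval := by
  have hcos (τ : ℝ) : Real.cos (w * τ) = Real.cos ((2 * j + 1 : ℕ) * τ) := by
    rw [← hw]
    rcases Int.natAbs_eq w with h | h <;> rw [h] <;> simp
  rcases hz with rfl | hz
  · convert Submodule.zero_mem _
    simp
  rcases Int.natAbs_eq z with h | h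
  · refine ⟨Finsupp.single (j, z.natAbs) 1, Finsupp.single_mem_supported ℝ _ hz, ?_⟩
    rw [trigEval_single]
    ext τ x
    rw [h]
    simp [trigMode, hcos]
  · refine ⟨Finsupp.single (j, z.natAbs) (-1), Finsupp.single_mem_supported ℝ _ hz, ?_⟩
    rw [trigEval_single]
    ext τ x
    rw [h]
    simp [trigMode, hcos]

/-- Sine polynomials of degree at most `K`. -/
def sinSpan (K : ℕ) : Submodule ℝ (ℝ → ℝ) :=
  Submodule.span ℝ {f | ∃ z : ℤ, z.natAbs ≤ K ∧ f = fun x => Real.sin (z * x)}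

theorem sinSpan_mono {K L : ℕ} (h : K ≤ L) : sinSpan K ≤ sinSpan L :=
  Submodule.span_mono fun _ ⟨z, hz, hf⟩ => ⟨z, hz.trans h, hf⟩

theorem cos_mul_mem_sinSpan {K : ℕ} (a : ℕ) {f : ℝ → ℝ} (hf : f ∈ sinSpan K) :
    (fun x => Real.cos (a * x) * f x) ∈ sinSpan (K + a) := by
  induction hf using Submodule.span_induction with
  | mem f hf =>
    obtain ⟨z, hz, rfl⟩ := hf
    have h : (fun x : ℝ => Real.cos (a * x) * Real.sin (z * x)) =
        (1 / 2 : ℝ) • (fun x : ℝ => Real.sin (((z + a : ℤ) : ℝ) * x)) +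
          (1 / 2 : ℝ) • (fun x : ℝ => Real.sin (((z - a : ℤ) : ℝ) * x)) := by
      ext x
      simp only [Pi.add_apply, Pi.smul_apply, smul_eq_mul]
      push_cast
      rw [sub_mul, add_mul, Real.sin_sub, Real.sin_add]
      ring
    rw [h]
    exact add_mem (Submodule.smul_mem _ _ (Submodule.subset_span ⟨_, by omega, rfl⟩))
      (Submodule.smul_mem _ _ (Submodule.subset_span ⟨_, by omega, rfl⟩))
  | zero =>
    convert Submodule.zero_mem _
    simp
  | add f g _ _ hf hg => simpa [mul_add] using! add_mem hf hg
  | smul r f _ hf => simpa [mul_left_comm] using! Submodule.smul_mem _ r hf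

theorem exists_sin_mul_eq {K : ℕ} (a : ℕ) {f : ℝ → ℝ} (hf : f ∈ sinSpan K) :
    ∃ g ∈ sinSpan (K + a), ∀ x, Real.sin ((a + 1 : ℕ) * x) * f x = Real.sin x * g x := by
  induction a with
  | zero => exact ⟨f, hf, by simp⟩
  | succ a ih =>
    obtain ⟨g, hg, h⟩ := ih
    refine ⟨_, add_mem (cos_mul_mem_sinSpan 1 hg) (cos_mul_mem_sinSpan (a + 1) hf), fun x => ?_⟩
    rw [show ((a + 1 + 1 : ℕ) : ℝ) * x = (a + 1 : ℕ) * x + x by push_cast; ring, Real.sin_add,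
      Pi.add_apply]
    simp only [Nat.cast_one, one_mul]
    linear_combination Real.cos x * h x

theorem exists_sin_mul_sin_mul_sin_eq {a b c : ℕ} (ha : 1 ≤ a) (hb : 1 ≤ b) :
    ∃ g ∈ sinSpan (a + b + c - 2), ∀ x : ℝ,
      Real.sin (a * x) * Real.sin (b * x) * Real.sin (c * x) = Real.sin x ^ 2 * g x := by
  obtain ⟨a, rfl⟩ := Nat.exists_eq_add_of_le' ha
  obtain ⟨b, rfl⟩ := Nat.exists_eq_add_of_le' hb
  have h : (fun x : ℝ => Real.sin (c * x)) ∈ sinSpan c :=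
    Submodule.subset_span ⟨c, by simp, by simp⟩
  obtain ⟨g, hg, hg'⟩ := exists_sin_mul_eq b h
  obtain ⟨k, hk, hk'⟩ := exists_sin_mul_eq a hg
  refine ⟨k, sinSpan_mono (by omega) hk, fun x => ?_⟩
  linear_combination Real.sin ((a + 1 : ℕ) * x) * hg' x + Real.sin x * hk' x

theorem cos_mul_mem_of_mem_sinSpan {A : Set (ℕ × ℕ)} {w : ℤ} {j K : ℕ}
    (hw : w.natAbs = 2 * j + 1) (hA : ∀ k, 1 ≤ k → k ≤ K → (j, k) ∈ A) {g : ℝ → ℝ}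
    (hg : g ∈ sinSpan K) :
    (fun τ x => Real.cos (w * τ) * g x) ∈ (Finsupp.supported ℝ ℝ A).map trigEval := by
  induction hg using Submodule.span_induction with
  | mem f hf =>
    obtain ⟨z, hz, rfl⟩ := hf
    refine cos_mul_sin_int_mem hw ?_
    by_cases h : z = 0
    · exact .inl h
    · exact .inr (hA _ (by omega) hz)
  | zero =>
    convert Submodule.zero_mem _
    simp
  | add f g _ _ hf hg => simpa [mul_add] using! add_mem hf hg
  | smul r f _ hf => simpa [mul_left_comm] using! Submodule.smul_mem _ r hf

theorem sinSq_mul_mem_map_sinSqEval {P : Submodule ℝ (ℕ × ℕ →₀ ℝ)} {f : ℝ → ℝ → ℝ}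
    (hf : f ∈ P.map trigEval) : (fun τ x => Real.sin x ^ 2 * f τ x) ∈ P.map sinSqEval := by
  obtain ⟨c, hc, rfl⟩ := hf
  exact ⟨c, hc, rfl⟩

theorem cos_mul_cos_mul_cos (a b c : ℝ) : Real.cos a * Real.cos b * Real.cos c =
    1 / 4 * (Real.cos (a + b + c) + Real.cos (a + b - c) + Real.cos (a - b + c) +
      Real.cos (a - b - c)) := by
  simp only [Real.cos_add, Real.cos_sub, Real.sin_add, Real.sin_sub]
  ring

theorem trigMode_mul_mem {N a b c : ℕ} {p q r : ℕ × ℕ} (hp : p ∈ orderBox N a)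
    (hq : q ∈ orderBox N b) (hr : r ∈ orderBox N c) :
    trigMode p * trigMode q * trigMode r ∈
      (Finsupp.supported ℝ ℝ (openBox N (a + b + c + 1))).map sinSqEval := by
  obtain ⟨j₁, k₁⟩ := p
  obtain ⟨j₂, k₂⟩ := q
  obtain ⟨j₃, k₃⟩ := r
  obtain ⟨hj₁, hk₁, hK₁⟩ := hp
  obtain ⟨hj₂, hk₂, hK₂⟩ := hq
  obtain ⟨hj₃, hk₃, hK₃⟩ := hr
  dsimp only at hj₁ hk₁ hK₁ hj₂ hk₂ hK₂ hj₃ hk₃ hK₃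
  obtain ⟨g, hg, h⟩ := exists_sin_mul_sin_mul_sin_eq (c := k₃) hk₁ hk₂
  have hK : (2 * (a + b + c + 1) + 1) * N =
      (2 * a + 1) * N + (2 * b + 1) * N + (2 * c + 1) * N := by ring
  have key (w : ℤ) (hw : w % 2 = 1) (hw' : w.natAbs ≤ 2 * (a + b + c + 1) + 1) :
      (fun τ x => Real.cos (w * τ) * g x) ∈
        (Finsupp.supported ℝ ℝ (openBox N (a + b + c + 1))).map trigEval := by
    refine cos_mul_mem_of_mem_sinSpan (j := w.natAbs / 2) (by omega) (fun k hk hk' => ?_) hg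
    exact ⟨by dsimp only; omega, hk, by dsimp only; omega⟩
  let m₁ : ℤ := 2 * j₁ + 1
  let m₂ : ℤ := 2 * j₂ + 1
  let m₃ : ℤ := 2 * j₃ + 1
  have h₁ := key (m₁ + m₂ + m₃) (by omega) (by omega)
  have h₂ := key (m₁ + m₂ - m₃) (by omega) (by omega)
  have h₃ := key (m₁ - m₂ + m₃) (by omega) (by omega)
  have h₄ := key (m₁ - m₂ - m₃) (by omega) (by omega)
  convert sinSq_mul_mem_map_sinSqEval (Submodule.smul_mem _ (1 / 4 : ℝ)
    (add_mem (add_mem h₁ h₂) (add_mem h₃ h₄))) using 1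
  ext τ x
  simp only [trigMode, Pi.mul_apply, Pi.add_apply, Pi.smul_apply, smul_eq_mul, m₁, m₂, m₃]
  have hc := cos_mul_cos_mul_cos ((2 * j₁ + 1) * τ) ((2 * j₂ + 1) * τ) ((2 * j₃ + 1) * τ)
  push_cast
  simp only [add_mul _ _ τ, sub_mul _ _ τ] at hc ⊢
  linear_combination (Real.sin (k₁ * x) * Real.sin (k₂ * x) * Real.sin (k₃ * x)) * hc +
    (1 / 4) * (Real.cos (2 * j₁ * τ + 1 * τ + (2 * j₂ * τ + 1 * τ) + (2 * j₃ * τ + 1 * τ)) +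
      Real.cos (2 * j₁ * τ + 1 * τ + (2 * j₂ * τ + 1 * τ) - (2 * j₃ * τ + 1 * τ)) +
      Real.cos (2 * j₁ * τ + 1 * τ - (2 * j₂ * τ + 1 * τ) + (2 * j₃ * τ + 1 * τ)) +
      Real.cos (2 * j₁ * τ + 1 * τ - (2 * j₂ * τ + 1 * τ) - (2 * j₃ * τ + 1 * τ))) * h x

theorem trigEval_mul_mem {N a b c : ℕ} {f g h : ℕ × ℕ →₀ ℝ}
    (hf : f ∈ Finsupp.supported ℝ ℝ (orderBox N a)) (hg : g ∈ Finsupp.supported ℝ ℝ (orderBox N b))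
    (hh : h ∈ Finsupp.supported ℝ ℝ (orderBox N c)) :
    trigEval f * trigEval g * trigEval h ∈
      (Finsupp.supported ℝ ℝ (openBox N (a + b + c + 1))).map sinSqEval := by
  have expand (e : ℕ × ℕ →₀ ℝ) : trigEval e = ∑ p ∈ e.support, e p • trigMode p := by
    rw [trigEval, Finsupp.linearCombination_apply, Finsupp.sum]
  rw [expand f, expand g, expand h, Finset.sum_mul_sum, Finset.sum_mul]
  refine sum_mem fun p hp => ?_
  rw [Finset.sum_mul_sum]
  refine sum_mem fun q hq => sum_mem fun r hr => ?_
  rw [smul_mul_smul_comm, smul_mul_smul_comm]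
  exact Submodule.smul_mem _ _ (trigMode_mul_mem (hf hp) (hg hq) (hh hr))

theorem sin_odd_mul_eq (n : ℕ) (x : ℝ) : Real.sin ((2 * n + 1) * x) =
    Real.sin x * (1 + ∑ l ∈ Finset.range n, 2 * Real.cos (2 * (l + 1) * x)) := by
  induction n with
  | zero => simp
  | succ n ih =>
    have h₁ : (2 * ((n + 1 : ℕ) : ℝ) + 1) * x = 2 * (n + 1) * x + x := by push_cast; ring
    have h₂ : (2 * (n : ℝ) + 1) * x = 2 * (n + 1) * x - x := by ring
    rw [h₂, Real.sin_sub] at ih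
    rw [Finset.sum_range_succ, h₁, Real.sin_add]
    linear_combination ih

/-- The Fejér kernel. -/
theorem sin_sq_mul_eq (N : ℕ) (x : ℝ) : Real.sin (N * x) ^ 2 = Real.sin x ^ 2 *
    (N + ∑ i ∈ Finset.range N, ∑ l ∈ Finset.range i, 2 * Real.cos (2 * (l + 1) * x)) := by
  induction N with
  | zero => simp
  | succ N ih =>
    have h := sin_odd_mul_eq N x
    have h₁ : (2 * (N : ℝ) + 1) * x = 2 * (N * x) + x := by ring
    have h₂ : ((N + 1 : ℕ) : ℝ) * x = N * x + x := by push_cast; ring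
    rw [h₁, Real.sin_add, Real.sin_two_mul, Real.cos_two_mul'] at h
    rw [Finset.sum_range_succ, h₂, Real.sin_add]
    push_cast
    linear_combination ih + Real.sin x * h + Real.sin (N * x) ^ 2 * Real.sin_sq_add_cos_sq x

/-- The frequencies produced by the nonconstant part of the Fejér kernel acting on `sin (M x)`. -/
noncomputable def fejerRemainder (N : ℕ) (M : ℤ) (x : ℝ) : ℝ :=
  ∑ i ∈ Finset.range N, ∑ l ∈ Finset.range i,
    (Real.sin (((M + 2 * (l + 1) : ℤ) : ℝ) * x) + Real.sin (((M - 2 * (l + 1) : ℤ) : ℝ) * x))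

theorem sin_sq_mul_sin_eq (N : ℕ) (M : ℤ) (x : ℝ) :
    Real.sin (N * x) ^ 2 * Real.sin (M * x) =
      Real.sin x ^ 2 * (N * Real.sin (M * x) + fejerRemainder N M x) := by
  have h : fejerRemainder N M x = (∑ i ∈ Finset.range N, ∑ l ∈ Finset.range i,
      2 * Real.cos (2 * (l + 1) * x)) * Real.sin (M * x) := by
    simp only [fejerRemainder, Finset.sum_mul]
    refine Finset.sum_congr rfl fun i _ => Finset.sum_congr rfl fun l _ => ?_
    push_cast
    rw [add_mul (M : ℝ), sub_mul (M : ℝ), Real.sin_add, Real.sin_sub]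
    ring
  rw [h, sin_sq_mul_eq]
  ring

theorem cos_mul_fejerRemainder_mem {A : Set (ℕ × ℕ)} {N j : ℕ} {w M : ℤ}
    (hw : w.natAbs = 2 * j + 1)
    (hA : ∀ d : ℤ, 1 ≤ d.natAbs → d.natAbs < N → M + 2 * d = 0 ∨ (j, (M + 2 * d).natAbs) ∈ A) :
    (fun τ x => Real.cos (w * τ) * fejerRemainder N M x) ∈
      (Finsupp.supported ℝ ℝ A).map trigEval := by
  have h : (fun τ x => Real.cos (w * τ) * fejerRemainder N M x) =
      ∑ i ∈ Finset.range N, ∑ l ∈ Finset.range i,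
        ((fun τ x => Real.cos (w * τ) * Real.sin (((M + 2 * (l + 1) : ℤ) : ℝ) * x)) +
          fun τ x => Real.cos (w * τ) * Real.sin (((M + 2 * (-(l + 1)) : ℤ) : ℝ) * x)) := by
    ext τ x
    simp only [fejerRemainder, Finset.sum_apply, Pi.add_apply, Finset.mul_sum, mul_add (cos _),
      mul_neg, ← sub_eq_add_neg]
  rw [h]
  refine sum_mem fun i hi => sum_mem fun l hl => ?_
  rw [Finset.mem_range] at hi hl
  exact add_mem (cos_mul_sin_int_mem hw (hA _ (by omega) (by omega)))
    (cos_mul_sin_int_mem hw (hA _ (by omega) (by omega)))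

theorem cos_mul_fejerRemainder_mem_nonresonant {N j i : ℕ} {w : ℤ} (hw : w.natAbs = 2 * i + 1)
    (hi : i = j ∨ i = j + 1 ∨ i + 1 = j) :
    (fun τ x => Real.cos (w * τ) * fejerRemainder N ((2 * j + 1) * N : ℕ) x) ∈
      (Finsupp.supported ℝ ℝ (nonresonantBox N (j + 1))).map trigEval := by
  refine cos_mul_fejerRemainder_mem hw fun d hd hd' => or_iff_not_imp_left.2 fun h => ?_
  have e₁ : (2 * j + 1) * N = 2 * (j * N) + N := by ring
  have e₂ : (2 * (j + 1) + 1) * N = 2 * (j * N) + 3 * N := by ring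
  have e₃ : (2 * i + 1) * N = 2 * (i * N) + N := by ring
  have e₄ : i * N = j * N ∨ i * N = j * N + N ∨ i * N + N = j * N := by
    rcases hi with rfl | rfl | rfl
    · exact .inl rfl
    · exact .inr (.inl (by ring))
    · exact .inr (.inr (by ring))
  refine ⟨⟨?_, ?_, ?_⟩, ?_⟩ <;> dsimp only <;> omega

theorem cos_mul_sin_resonant_mem_nonresonant {N j i : ℕ} {w : ℤ} (hN : 0 < N)
    (hw : w.natAbs = 2 * i + 1) (hi : i = j + 1 ∨ i + 1 = j) :
    (fun τ x => Real.cos (w * τ) * Real.sin ((((2 * j + 1) * N : ℕ) : ℤ) * x)) ∈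
      (Finsupp.supported ℝ ℝ (nonresonantBox N (j + 1))).map trigEval := by
  refine cos_mul_sin_int_mem hw (.inr ?_)
  have e₁ : (2 * j + 1) * N = 2 * (j * N) + N := by ring
  have e₂ : (2 * (j + 1) + 1) * N = 2 * (j * N) + 3 * N := by ring
  have e₃ : (2 * i + 1) * N = 2 * (i * N) + N := by ring
  have e₄ : i * N = j * N + N ∨ i * N + N = j * N := by
    rcases hi with rfl | rfl
    · exact .inl (by ring)
    · exact .inr (by ring)
  refine ⟨⟨?_, ?_, ?_⟩, ?_⟩ <;> dsimp only <;> omega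

theorem trigEval_resonantMode (N j : ℕ) (τ x : ℝ) : trigEval (resonantMode N j) τ x =
    Real.cos ((2 * j + 1 : ℕ) * τ) * Real.sin (((2 * j + 1) * N : ℕ) * x) := by
  simp [resonantMode, trigEval_single, trigMode]

theorem cos_sq_mul_cos (a τ : ℝ) : Real.cos τ ^ 2 * Real.cos (a * τ) =
    1 / 2 * Real.cos (a * τ) + 1 / 4 * Real.cos ((a + 2) * τ) + 1 / 4 * Real.cos ((a - 2) * τ) := by
  rw [add_mul, sub_mul, Real.cos_add, Real.cos_sub, Real.cos_two_mul]
  ring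

theorem trigEval_resonantMode_mul (N j : ℕ) (τ x : ℝ) :
    trigEval (resonantMode N 0) τ x * trigEval (resonantMode N 0) τ x *
      trigEval (resonantMode N j) τ x = Real.sin x ^ 2 *
        ((1 / 2 * Real.cos ((2 * j + 1 : ℕ) * τ) + 1 / 4 * Real.cos (((2 * j + 1 : ℕ) + 2) * τ) +
          1 / 4 * Real.cos (((2 * j + 1 : ℕ) - 2) * τ)) *
        (N * Real.sin (((2 * j + 1) * N : ℕ) * x) +
          fejerRemainder N ((2 * j + 1) * N : ℕ) x)) := by
  have h := sin_sq_mul_sin_eq N ((2 * j + 1) * N : ℕ) x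
  rw [Int.cast_natCast] at h
  simp only [trigEval_resonantMode]
  rw [← cos_sq_mul_cos]
  simp only [mul_zero, zero_add, one_mul, Nat.cast_one]
  linear_combination (Real.cos τ ^ 2 * Real.cos ((2 * j + 1 : ℕ) * τ)) * h

theorem resonantMode_cube_mem {N : ℕ} (hN : 0 < N) :
    trigEval (resonantMode N 0) * trigEval (resonantMode N 0) * trigEval (resonantMode N 0) -
      sinSqEval ((3 * N / 4 : ℝ) • resonantMode N 0) ∈
      (Finsupp.supported ℝ ℝ (nonresonantBox N 1)).map sinSqEval := by
  have h₁ := cos_mul_fejerRemainder_mem_nonresonant (N := N) (j := 0) (i := 0) (w := 1) (by simp)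
    (.inl rfl)
  have h₂ := cos_mul_fejerRemainder_mem_nonresonant (N := N) (j := 0) (i := 1) (w := 3) (by simp)
    (.inr (.inl rfl))
  have h₃ := cos_mul_sin_resonant_mem_nonresonant (j := 0) (i := 1) (w := 3) hN (by simp) (.inl rfl)
  convert sinSq_mul_mem_map_sinSqEval (add_mem (Submodule.smul_mem _ (3 / 4 : ℝ) h₁)
    (add_mem (Submodule.smul_mem _ (1 / 4 : ℝ) h₂) (Submodule.smul_mem _ (N / 4 : ℝ) h₃))) using 1
  ext τ x
  simp only [Pi.sub_apply, Pi.mul_apply, map_smul, Pi.smul_apply, Pi.add_apply, smul_eq_mul,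
    sinSqEval_apply]
  rw [trigEval_resonantMode_mul, trigEval_resonantMode]
  norm_num
  ring

theorem resonantMode_sq_mul_mem {N j : ℕ} (hN : 0 < N) (hj : 1 ≤ j) :
    trigEval (resonantMode N 0) * trigEval (resonantMode N 0) * trigEval (resonantMode N j) -
      sinSqEval ((N / 2 : ℝ) • resonantMode N j) ∈
      (Finsupp.supported ℝ ℝ (nonresonantBox N (j + 1))).map sinSqEval := by
  have hm : ((2 * j + 1 : ℕ) + 2 : ℤ).natAbs = 2 * (j + 1) + 1 := by omega
  have hp : ((2 * j + 1 : ℕ) - 2 : ℤ).natAbs = 2 * (j - 1) + 1 := by omega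
  have h₁ := cos_mul_fejerRemainder_mem_nonresonant (N := N) (j := j) (i := j)
    (w := (2 * j + 1 : ℕ)) (by simp only [Int.natAbs_natCast]) (.inl rfl)
  have h₂ := cos_mul_fejerRemainder_mem_nonresonant (N := N) (j := j) hm (.inr (.inl rfl))
  have h₃ := cos_mul_fejerRemainder_mem_nonresonant (N := N) (j := j) hp (.inr (.inr (by omega)))
  have h₄ := cos_mul_sin_resonant_mem_nonresonant (j := j) hN hm (.inl rfl)
  have h₅ := cos_mul_sin_resonant_mem_nonresonant (j := j) hN hp (.inr (by omega))
  convert sinSq_mul_mem_map_sinSqEval (add_mem (Submodule.smul_mem _ (1 / 2 : ℝ) h₁)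
    (add_mem (Submodule.smul_mem _ (1 / 4 : ℝ) (add_mem h₂ h₃))
      (Submodule.smul_mem _ (N / 4 : ℝ) (add_mem h₄ h₅)))) using 1
  ext τ x
  simp only [Pi.sub_apply, Pi.mul_apply, map_smul, Pi.smul_apply, Pi.add_apply, smul_eq_mul,
    sinSqEval_apply]
  rw [trigEval_resonantMode_mul, trigEval_resonantMode]
  push_cast
  ring

/-- The coefficient of `εⁿ` in the cube of `∑ εⁱ f i`. -/
def cubeCoeff {R : Type*} [CommRing R] (f : ℕ → R) (n : ℕ) : R :=
  ∑ i ∈ Finset.range (n + 1), ∑ j ∈ Finset.range (n + 1 - i), f i * f j * f (n - i - j)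

/-- The part of `cubeCoeff f (n + 1)` not involving `f (n + 1)`. -/
def cubeRemainder {R : Type*} [CommRing R] (f : ℕ → R) (n : ℕ) : R :=
  ∑ j ∈ Finset.range n, f 0 * f (j + 1) * f (n - j) +
    ∑ i ∈ Finset.range n, ∑ j ∈ Finset.range (n + 1 - i), f (i + 1) * f j * f (n - i - j)

theorem cubeCoeff_succ {R : Type*} [CommRing R] (f : ℕ → R) (n : ℕ) :
    cubeCoeff f (n + 1) = 3 * (f 0 * f 0 * f (n + 1)) + cubeRemainder f n := by
  have h (i : ℕ) : ∑ j ∈ Finset.range (n + 1 + 1 - (i + 1)),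
      f (i + 1) * f j * f (n + 1 - (i + 1) - j) =
      ∑ j ∈ Finset.range (n + 1 - i), f (i + 1) * f j * f (n - i - j) := by
    simp only [Nat.add_sub_add_right]
  have h₀ : ∑ j ∈ Finset.range (n + 1 + 1 - 0), f 0 * f j * f (n + 1 - 0 - j) =
      f 0 * f 0 * f (n + 1) + f 0 * f (n + 1) * f 0 +
        ∑ j ∈ Finset.range n, f 0 * f (j + 1) * f (n - j) := by
    rw [Nat.sub_zero, Finset.sum_range_succ', Finset.sum_range_succ]
    simp only [Nat.sub_zero, Nat.add_sub_add_right, Nat.sub_self]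
    ring
  rw [cubeCoeff, Finset.sum_range_succ', h₀, Finset.sum_congr rfl fun i _ => h i,
    Finset.sum_range_succ, cubeRemainder]
  simp
  ring

theorem cubeCoeff_congr {R : Type*} [CommRing R] {f g : ℕ → R} {n : ℕ}
    (h : ∀ i ≤ n, f i = g i) : cubeCoeff f n = cubeCoeff g n := by
  refine Finset.sum_congr rfl fun i hi => Finset.sum_congr rfl fun j hj => ?_
  rw [Finset.mem_range] at hi hj
  rw [h i (by omega), h j (by omega), h _ (by omega)]

theorem cubeRemainder_congr {R : Type*} [CommRing R] {f g : ℕ → R} {n : ℕ}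
    (h : ∀ i ≤ n, f i = g i) : cubeRemainder f n = cubeRemainder g n := by
  refine congrArg₂ (· + ·) (Finset.sum_congr rfl fun j hj => ?_)
    (Finset.sum_congr rfl fun i hi => Finset.sum_congr rfl fun j hj => ?_)
  · rw [Finset.mem_range] at hj
    rw [h 0 (by omega), h (j + 1) (by omega), h _ (by omega)]
  · rw [Finset.mem_range] at hi hj
    rw [h (i + 1) (by omega), h j (by omega), h _ (by omega)]

/-- `sin² x` times the source term at order `n + 1`, where `d n = (u_n, ω_{n+1})`. -/
noncomputable def lindstedtSource (d : ℕ → (ℕ × ℕ →₀ ℝ) × ℝ) (n : ℕ) : ℝ → ℝ → ℝ :=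
  sinSqEval (∑ k ∈ Finset.range (n + 1), (d k).2 • timeLaplacian (d (n - k)).1) +
    cubeCoeff (fun i => trigEval (d i).1) n

/-- The part of `lindstedtSource d (n + 1)` depending only on `d 0, …, d n`. -/
noncomputable def lindstedtRemainder (d : ℕ → (ℕ × ℕ →₀ ℝ) × ℝ) (n : ℕ) : ℝ → ℝ → ℝ :=
  sinSqEval (∑ k ∈ Finset.range n, (d (k + 1)).2 • timeLaplacian (d (n - k)).1) +
    cubeRemainder (fun i => trigEval (d i).1) n

theorem lindstedtSource_succ (d : ℕ → (ℕ × ℕ →₀ ℝ) × ℝ) (n : ℕ) :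
    lindstedtSource d (n + 1) =
      sinSqEval ((d (n + 1)).2 • timeLaplacian (d 0).1 +
        (d 0).2 • timeLaplacian (d (n + 1)).1) +
      3 * (trigEval (d 0).1 * trigEval (d 0).1 * trigEval (d (n + 1)).1) +
      lindstedtRemainder d n := by
  rw [lindstedtSource, lindstedtRemainder, cubeCoeff_succ, Finset.sum_range_succ,
    Finset.sum_range_succ']
  simp only [Nat.add_sub_add_right, Nat.sub_self, Nat.sub_zero, map_add]
  ring

theorem lindstedtSource_congr {d e : ℕ → (ℕ × ℕ →₀ ℝ) × ℝ} {n : ℕ}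
    (h : ∀ i ≤ n, d i = e i) : lindstedtSource d n = lindstedtSource e n := by
  rw [lindstedtSource, lindstedtSource, cubeCoeff_congr fun i hi => by rw [h i hi]]
  congr 2
  refine Finset.sum_congr rfl fun k hk => ?_
  rw [Finset.mem_range] at hk
  rw [h k (by omega), h _ (by omega)]

theorem lindstedtRemainder_congr {d e : ℕ → (ℕ × ℕ →₀ ℝ) × ℝ} {n : ℕ}
    (h : ∀ i ≤ n, d i = e i) : lindstedtRemainder d n = lindstedtRemainder e n := by
  rw [lindstedtRemainder, lindstedtRemainder, cubeRemainder_congr fun i hi => by rw [h i hi]]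
  congr 2
  refine Finset.sum_congr rfl fun k hk => ?_
  rw [Finset.mem_range] at hk
  rw [h (k + 1) (by omega), h _ (by omega)]

theorem orderBox_subset_openBox {N i n : ℕ} (hN : 0 < N) (h : i < n) :
    orderBox N i ⊆ openBox N n := by
  rintro p ⟨h₁, h₂, h₃⟩
  refine ⟨by omega, h₂, h₃.trans_lt ?_⟩
  exact Nat.mul_lt_mul_of_pos_right (by omega) hN

theorem openBox_mono {N i n : ℕ} (h : i ≤ n) : openBox N i ⊆ openBox N n := by
  rintro p ⟨h₁, h₂, h₃⟩
  exact ⟨h₁.trans h, h₂, h₃.trans_le (Nat.mul_le_mul_right _ (by omega))⟩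

theorem nonresonantBox_mono {N i n : ℕ} (h : i ≤ n) :
    nonresonantBox N i ⊆ nonresonantBox N n := by
  rintro p ⟨⟨h₁, h₂, h₃⟩, h₄⟩
  exact ⟨⟨h₁.trans h, h₂, h₃.trans (Nat.mul_le_mul_right _ (by omega))⟩, h₄⟩

theorem resonantMode_mem {N j n : ℕ} (hN : 0 < N) (h : j ≤ n) :
    resonantMode N j ∈ Finsupp.supported ℝ ℝ (orderBox N n) :=
  Finsupp.single_mem_supported ℝ _
    ⟨h, Nat.mul_pos (by omega) hN, Nat.mul_le_mul_right _ (by omega)⟩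

theorem lindstedtRemainder_mem {N n : ℕ} (hN : 0 < N) {d : ℕ → (ℕ × ℕ →₀ ℝ) × ℝ}
    (hd : ∀ i ≤ n, (d i).1 ∈ Finsupp.supported ℝ ℝ (orderBox N i)) :
    lindstedtRemainder d n ∈
      (Finsupp.supported ℝ ℝ (openBox N (n + 2))).map sinSqEval := by
  refine add_mem ⟨_, ?_, rfl⟩ (add_mem (sum_mem fun j hj => ?_)
    (sum_mem fun i hi => sum_mem fun j hj => ?_))
  · refine sum_mem fun k hk => Submodule.smul_mem _ _ (trigMultiplier_mem_supported _ ?_)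
    exact Finsupp.supported_mono (orderBox_subset_openBox hN (by omega)) (hd (n - k) (by omega))
  · rw [Finset.mem_range] at hj
    refine Submodule.map_mono (Finsupp.supported_mono (openBox_mono ?_))
      (trigEval_mul_mem (hd 0 (by omega)) (hd (j + 1) (by omega)) (hd (n - j) (by omega)))
    omega
  · rw [Finset.mem_range] at hi hj
    refine Submodule.map_mono (Finsupp.supported_mono (openBox_mono ?_))
      (trigEval_mul_mem (hd (i + 1) (by omega)) (hd j (by omega)) (hd (n - i - j) (by omega)))
    omega

/-- Splitting off the resonant modes. -/
theorem exists_nonresonant_add_sum {N n : ℕ} {c : ℕ × ℕ →₀ ℝ}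
    (hc : c ∈ Finsupp.supported ℝ ℝ (openBox N n)) :
    ∃ r ∈ Finsupp.supported ℝ ℝ (nonresonantBox N n), ∃ b : ℕ → ℝ,
      c = r + ∑ j ∈ Finset.range n, b j • resonantMode N j := by
  refine ⟨c - ∑ j ∈ Finset.range n, c (j, (2 * j + 1) * N) • resonantMode N j, ?_,
    fun j => c (j, (2 * j + 1) * N), by simp⟩
  rw [Finsupp.mem_supported'] at hc ⊢
  rintro ⟨j, k⟩ hp
  have hsum : (∑ i ∈ Finset.range n, c (i, (2 * i + 1) * N) • resonantMode N i) (j, k) =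
      if j < n ∧ k = (2 * j + 1) * N then c (j, k) else 0 := by
    simp only [Finsupp.finsetSum_apply, Finsupp.smul_apply, resonantMode, Finsupp.single_apply,
      Prod.mk.injEq, smul_eq_mul, mul_ite, mul_one, mul_zero]
    split_ifs with h
    · rw [Finset.sum_eq_single j]
      · simp [h.2]
      · intro i _ hi
        simp [hi]
      · simp [h.1]
    · refine Finset.sum_eq_zero fun i hi => if_neg ?_
      rintro ⟨rfl, rfl⟩
      exact h ⟨Finset.mem_range.1 hi, rfl⟩
  rw [Finsupp.sub_apply, hsum]
  split_ifs with h
  · simp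
  · rw [sub_zero]
    refine hc _ fun hp' => ?_
    obtain ⟨h₁, h₂, h₃⟩ := hp'
    dsimp only at h₁ h₂ h₃
    refine hp ⟨⟨h₁, h₂, h₃.le⟩, fun h₄ => h ⟨?_, h₄⟩⟩
    dsimp only at h₄
    rw [h₄] at h₃
    have := Nat.lt_of_mul_lt_mul_right h₃
    omega

theorem trigMultiplier_resonantMode (w : ℕ × ℕ → ℝ) (N j : ℕ) :
    trigMultiplier w (resonantMode N j) = w (j, (2 * j + 1) * N) • resonantMode N j := by
  simp [trigMultiplier, resonantMode]

theorem waveOperator_resonantMode (N j : ℕ) : waveOperator N (resonantMode N j) = 0 := by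
  rw [waveOperator, trigMultiplier_resonantMode]
  push_cast
  rw [show ((2 * j + 1 : ℝ) * N) ^ 2 - (N : ℝ) ^ 2 * (2 * j + 1) ^ 2 = 0 by ring, zero_smul]

theorem initialCoeff_resonantMode_zero (N : ℕ) : initialCoeff N (resonantMode N 0) = 1 := by
  simp [initialCoeff, resonantMode]

theorem initialCoeff_resonantMode_succ {N : ℕ} (hN : 0 < N) (j : ℕ) :
    initialCoeff N (resonantMode N (j + 1)) = 0 := by
  simp [initialCoeff, resonantMode, hN.ne']

theorem exists_waveOperator_eq {N n : ℕ} {s : ℕ × ℕ →₀ ℝ}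
    (hs : s ∈ Finsupp.supported ℝ ℝ (nonresonantBox N n)) :
    ∃ w ∈ Finsupp.supported ℝ ℝ (nonresonantBox N n), waveOperator N w = s := by
  refine ⟨trigMultiplier (fun p => ((p.2 : ℝ) ^ 2 - (N : ℝ) ^ 2 * (2 * p.1 + 1) ^ 2)⁻¹) s,
    trigMultiplier_mem_supported _ hs, ?_⟩
  ext p
  rw [waveOperator, trigMultiplier_apply, trigMultiplier_apply]
  by_cases hp : p ∈ nonresonantBox N n
  · refine mul_inv_cancel_left₀ ?_ _
    have h := hp.2
    rw [← mul_pow, sub_ne_zero]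
    intro h'
    rw [sq_eq_sq₀ (by positivity) (by positivity)] at h'
    refine h ?_
    rw [mul_comm]
    exact_mod_cast h'
  · rw [(Finsupp.mem_supported' _ _).1 hs p hp]
    simp

/-- The hierarchy at order `n`, together with solvability at order `n + 1`. -/
def LindstedtOrder (N : ℕ) : ℕ → (ℕ → (ℕ × ℕ →₀ ℝ) × ℝ) → Prop
  | 0, d => d 0 = (resonantMode N 0, (3 * N / 4 : ℝ))
  | n + 1, d => (d (n + 1)).1 ∈ Finsupp.supported ℝ ℝ (orderBox N (n + 1)) ∧
      initialCoeff N (d (n + 1)).1 = 0 ∧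
      sinSqEval (waveOperator N (d (n + 1)).1) + lindstedtSource d n = 0 ∧
      lindstedtSource d (n + 1) ∈
        (Finsupp.supported ℝ ℝ (nonresonantBox N (n + 2))).map sinSqEval

theorem LindstedtOrder.congr {N n : ℕ} {d e : ℕ → (ℕ × ℕ →₀ ℝ) × ℝ}
    (h : ∀ i ≤ n, d i = e i) (hd : LindstedtOrder N n d) : LindstedtOrder N n e := by
  cases n with
  | zero => exact (h 0 le_rfl).symm.trans hd
  | succ n =>
    rwa [LindstedtOrder, h _ le_rfl, lindstedtSource_congr h,
      lindstedtSource_congr fun i hi => h i (by omega)] at hd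

theorem LindstedtOrder.mem_supported {N n : ℕ} (hN : 0 < N) {d : ℕ → (ℕ × ℕ →₀ ℝ) × ℝ}
    (hd : LindstedtOrder N n d) : (d n).1 ∈ Finsupp.supported ℝ ℝ (orderBox N n) := by
  cases n with
  | zero =>
    rw [LindstedtOrder] at hd
    rw [hd]
    exact resonantMode_mem hN le_rfl
  | succ n => exact hd.1

theorem LindstedtOrder.source_mem {N n : ℕ} (hN : 0 < N) {d : ℕ → (ℕ × ℕ →₀ ℝ) × ℝ}
    (hd : LindstedtOrder N n d) : lindstedtSource d n ∈
      (Finsupp.supported ℝ ℝ (nonresonantBox N (n + 1))).map sinSqEval := by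
  cases n with
  | zero =>
    rw [LindstedtOrder] at hd
    convert resonantMode_cube_mem hN using 1
    simp [lindstedtSource, cubeCoeff, hd, timeLaplacian, trigMultiplier_resonantMode]
    ring
  | succ n => exact hd.2.2.2

theorem exists_lindstedtOrder_succ {N : ℕ} (hN : 0 < N) (n : ℕ) {d : ℕ → (ℕ × ℕ →₀ ℝ) × ℝ}
    (hd : ∀ m ≤ n, LindstedtOrder N m d) :
    ∃ a, LindstedtOrder N (n + 1) (Function.update d (n + 1) a) := by
  have hd₀ : d 0 = (resonantMode N 0, (3 * N / 4 : ℝ)) := hd 0 (Nat.zero_le n)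
  obtain ⟨s, hs, hs'⟩ := (hd n le_rfl).source_mem hN
  obtain ⟨w, hw, rfl⟩ := exists_waveOperator_eq hs
  have hwbox : w ∈ Finsupp.supported ℝ ℝ (orderBox N (n + 1)) :=
    Finsupp.supported_mono (fun _ hp => hp.1) hw
  set w' := -w + initialCoeff N w • resonantMode N 0
  have hw' : w' ∈ Finsupp.supported ℝ ℝ (orderBox N (n + 1)) :=
    add_mem (neg_mem hwbox) (Submodule.smul_mem _ _ (resonantMode_mem hN (Nat.zero_le _)))
  have hknown : sinSqEval ((3 * N / 4 : ℝ) • timeLaplacian w') +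
      3 * (trigEval (resonantMode N 0) * trigEval (resonantMode N 0) * trigEval w') +
      lindstedtRemainder d n ∈ (Finsupp.supported ℝ ℝ (openBox N (n + 2))).map sinSqEval := by
    refine add_mem (add_mem ⟨_, Submodule.smul_mem _ _ (trigMultiplier_mem_supported _
      (Finsupp.supported_mono (orderBox_subset_openBox hN (by omega)) hw')), rfl⟩ ?_)
      (lindstedtRemainder_mem hN fun i hi => (hd i hi).mem_supported hN)
    have h₀ := resonantMode_mem hN (le_refl 0)
    have h := trigEval_mul_mem h₀ h₀ hw'
    rw [show 0 + 0 + (n + 1) + 1 = n + 2 by omega] at h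
    convert Submodule.smul_mem _ (3 : ℝ) h using 1
    ext τ x
    simp
  obtain ⟨k, hk, hk'⟩ := hknown
  obtain ⟨r, hr, b, rfl⟩ := exists_nonresonant_add_sum hk
  let c (j : ℕ) : ℝ := -b (j + 1) / (3 * N / 2 - 3 * N / 4 * (2 * (j + 1 : ℕ) + 1) ^ 2)
  have hc (j : ℕ) : b (j + 1) + c j * (3 * N / 2 - 3 * N / 4 * (2 * (j + 1 : ℕ) + 1) ^ 2) = 0 := by
    have hNR : (0 : ℝ) < N := by exact_mod_cast hN
    have h : (3 * N / 2 - 3 * N / 4 * (2 * (j + 1 : ℕ) + 1) ^ 2 : ℝ) ≠ 0 := by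
      push_cast
      have : (0 : ℝ) ≤ j := j.cast_nonneg
      nlinarith [mul_nonneg hNR.le this, mul_nonneg (mul_nonneg hNR.le this) this]
    rw [div_mul_cancel₀ _ h, add_neg_cancel]
  let v : ℕ × ℕ →₀ ℝ := ∑ j ∈ Finset.range (n + 1), c j • resonantMode N (j + 1)
  have hv : v ∈ Finsupp.supported ℝ ℝ (orderBox N (n + 1)) := sum_mem fun j hj =>
    Submodule.smul_mem _ _ (resonantMode_mem hN (by rw [Finset.mem_range] at hj; omega))
  refine ⟨(w' + v, b 0), ?_⟩
  have hlow (i : ℕ) (hi : i ≤ n) : Function.update d (n + 1) (w' + v, b 0) i = d i :=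
    Function.update_of_ne (by omega) _ _
  rw [LindstedtOrder, lindstedtSource_congr hlow, lindstedtSource_succ,
    lindstedtRemainder_congr hlow, hlow 0 (Nat.zero_le n), Function.update_self, hd₀]
  refine ⟨add_mem hw' hv, ?_, ?_, ?_⟩
  · simp [v, w', initialCoeff_resonantMode_zero, initialCoeff_resonantMode_succ hN]
  · simp [v, w', waveOperator_resonantMode, ← hs']
  · have hres (j : ℕ) :
        trigEval (resonantMode N 0) * trigEval (resonantMode N 0) *
            trigEval (resonantMode N (j + 1)) -
          sinSqEval ((N / 2 : ℝ) • resonantMode N (j + 1)) ∈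
        (Finsupp.supported ℝ ℝ (nonresonantBox N (j + 2))).map sinSqEval :=
      resonantMode_sq_mul_mem hN (by omega)
    have hmem : sinSqEval r + ∑ j ∈ Finset.range (n + 1), (3 * c j) •
        (trigEval (resonantMode N 0) * trigEval (resonantMode N 0) *
          trigEval (resonantMode N (j + 1)) -
            sinSqEval ((N / 2 : ℝ) • resonantMode N (j + 1))) ∈
        (Finsupp.supported ℝ ℝ (nonresonantBox N (n + 2))).map sinSqEval := by
      refine add_mem ⟨r, hr, rfl⟩ (sum_mem fun j hj => Submodule.smul_mem _ _ ?_)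
      rw [Finset.mem_range] at hj
      exact Submodule.map_mono (Finsupp.supported_mono (nonresonantBox_mono (by omega))) (hres j)
    convert hmem using 1
    have hcoef : b 0 • timeLaplacian (resonantMode N 0) + (3 * N / 4 : ℝ) • timeLaplacian v +
        ∑ j ∈ Finset.range (n + 2), b j • resonantMode N j =
          -∑ j ∈ Finset.range (n + 1), (3 * c j) • (N / 2 : ℝ) • resonantMode N (j + 1) := by
      have h : ∑ j ∈ Finset.range (n + 1), (3 * N / 4 : ℝ) • c j •
            (-(2 * (j + 1 : ℕ) + 1 : ℝ) ^ 2) • resonantMode N (j + 1) +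
          ∑ j ∈ Finset.range (n + 1), b (j + 1) • resonantMode N (j + 1) =
          -∑ j ∈ Finset.range (n + 1), (3 * c j) • (N / 2 : ℝ) • resonantMode N (j + 1) := by
        rw [← Finset.sum_add_distrib, ← Finset.sum_neg_distrib]
        refine Finset.sum_congr rfl fun j _ => ?_
        simp only [smul_smul, ← add_smul, ← neg_smul]
        congr 1
        linear_combination hc j
      rw [Finset.sum_range_succ', ← h]
      simp only [v, map_sum, map_smul, timeLaplacian, trigMultiplier_resonantMode, Finset.smul_sum]
      simp only [Nat.cast_zero, mul_zero, zero_add, one_pow, neg_smul, smul_neg, one_smul]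
      abel
    have hev : trigEval v = ∑ j ∈ Finset.range (n + 1), c j • trigEval (resonantMode N (j + 1)) := by
      simp [v]
    have hcoef' := congrArg sinSqEval hcoef
    have hcube : 3 * (trigEval (resonantMode N 0) * trigEval (resonantMode N 0) * trigEval v) =
        ∑ j ∈ Finset.range (n + 1), (3 * c j) • (trigEval (resonantMode N 0) *
          trigEval (resonantMode N 0) * trigEval (resonantMode N (j + 1))) := by
      rw [hev, Finset.mul_sum, Finset.mul_sum]
      refine Finset.sum_congr rfl fun j _ => ?_
      ext τ x
      simp
      ring
    simp only [smul_sub, Finset.sum_sub_distrib, ← hcube]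
    simp only [map_add, map_neg, map_sum, map_smul, smul_add, mul_add] at hk' hcoef' ⊢
    linear_combination hcoef' - hk'

/-- Recursive construction of a sequence whose `n`-th condition only involves its first `n + 1`
terms. -/
theorem exists_seq_of_forall_update {α : Type*} [Inhabited α] (P : ℕ → (ℕ → α) → Prop)
    (hcongr : ∀ n f g, (∀ i ≤ n, f i = g i) → P n f → P n g)
    (hstep : ∀ n f, (∀ m < n, P m f) → ∃ a, P n (Function.update f n a)) :
    ∃ f, ∀ n, P n f := by
  classical
  choose! a ha using hstep
  let g : ℕ → ℕ → α := fun n => Nat.rec (fun _ => default)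
    (fun n f => Function.update f n (a n f)) n
  have hg (n : ℕ) : g (n + 1) = Function.update (g n) n (a n (g n)) := rfl
  have hstable (i k : ℕ) : g (i + 1 + k) i = g (i + 1) i := by
    induction k with
    | zero => rfl
    | succ k ih => rw [← add_assoc, hg, Function.update_of_ne (by omega), ih]
  have hlow (n i : ℕ) (hi : i < n) : g n i = g (i + 1) i := by
    obtain ⟨k, rfl⟩ := Nat.exists_eq_add_of_le (Nat.succ_le_of_lt hi)
    exact hstable i k
  refine ⟨fun i => g (i + 1) i, fun n => ?_⟩
  induction n using Nat.strong_induction_on with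
  | _ n ih =>
    refine hcongr n (g (n + 1)) _ (fun i hi => hlow (n + 1) i (by omega)) ?_
    rw [hg]
    exact ha n (g n) fun m hm => hcongr m _ _ (fun i hi => (hlow n i (by omega)).symm) (ih m hm)

/-- The Poincaré–Lindstedt hierarchy for the cubic conformal wave
equation can be solved order by order to arbitrary order. -/
theorem poincare_lindstedt_expansion (N : ℕ) (hN : 0 < N) :
    ∃ (ω : ℕ → ℝ) (u : ℕ → ℝ → ℝ → ℝ),
      (∀ n, ContDiff ℝ (⊤ : ℕ∞) (Function.uncurry (u n))) ∧
      (∀ τ x : ℝ, u 0 τ x = Real.cos τ * Real.sin (N * x)) ∧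
      (∀ n, 1 ≤ n → ∃ c : ℕ → ℕ → ℝ, ∀ τ x : ℝ,
        u n τ x = ∑ j ∈ Finset.range (n + 1), ∑ k ∈ Finset.Icc 1 ((2 * n + 1) * N),
          c j k * Real.cos ((2 * j + 1 : ℕ) * τ) * Real.sin ((k : ℕ) * x)) ∧
      (∀ n, 1 ≤ n → ∫ x in (0:ℝ)..π, u n 0 x * Real.sin (N * x) = 0) ∧
      (∀ n, 1 ≤ n → ∀ τ x : ℝ, x ∈ Set.Ioo 0 π →
        (N : ℝ) ^ 2 * deriv (deriv (fun t => u n t x)) τ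
          - deriv (deriv (fun y => u n τ y)) x
          + ∑ k ∈ Finset.Icc 1 n, ω k * deriv (deriv (fun t => u (n - k) t x)) τ
          + ((Real.sin x) ^ 2)⁻¹ *
              ∑ i ∈ Finset.range n, ∑ j ∈ Finset.range (n - i),
                u i τ x * u j τ x * u (n - 1 - i - j) τ x = 0) := by
  obtain ⟨d, hd⟩ := exists_seq_of_forall_update (LindstedtOrder N)
    (fun n f g h hf => hf.congr h) (fun n f hf => by
      cases n with
      | zero => exact ⟨_, Function.update_self ..⟩
      | succ n => exact exists_lindstedtOrder_succ hN n fun m hm => hf m (by omega))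
  have hd₀ : d 0 = (resonantMode N 0, (3 * N / 4 : ℝ)) := hd 0
  refine ⟨fun k => (d (k - 1)).2, fun n => trigEval (d n).1, fun n => contDiff_trigEval _, ?_, ?_,
    ?_, ?_⟩
  · intro τ x
    simp [hd₀, trigEval_resonantMode]
  · exact fun n _ => ⟨fun j k => (d n).1 (j, k),
      trigEval_of_mem_supported_orderBox ((hd n).mem_supported hN)⟩
  · intro n hn
    obtain ⟨n, rfl⟩ := Nat.exists_eq_add_of_le' hn
    rw [integral_trigEval_mul_sin hN, (hd (n + 1)).2.1, mul_zero]
  · intro n hn τ x hx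
    obtain ⟨n, rfl⟩ := Nat.exists_eq_add_of_le' hn
    have hsin : Real.sin x ^ 2 ≠ 0 := pow_ne_zero _ (Real.sin_pos_of_mem_Ioo hx).ne'
    have h := congrFun (congrFun (hd (n + 1)).2.2.1 τ) x
    simp only [lindstedtSource, cubeCoeff, Pi.add_apply, Pi.zero_apply, sinSqEval_apply,
      Finset.sum_apply, Pi.mul_apply, map_sum, map_smul, Pi.smul_apply, smul_eq_mul,
      trigEval_waveOperator, mul_left_comm _ (Real.sin x ^ 2), ← Finset.mul_sum] at h
    have hsum : ∑ k ∈ Finset.Icc 1 (n + 1), (d (k - 1)).2 *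
        deriv (deriv fun t => trigEval (d (n + 1 - k)).1 t x) τ =
        ∑ k ∈ Finset.range (n + 1), (d k).2 * trigEval (timeLaplacian (d (n - k)).1) τ x := by
      have hIcc : Finset.Icc 1 (n + 1) = Finset.Ico 1 (n + 1 + 1) := by
        ext k
        simp only [Finset.mem_Icc, Finset.mem_Ico]
        omega
      rw [hIcc, Finset.sum_Ico_eq_sum_range]
      refine Finset.sum_congr rfl fun k _ => ?_
      rw [deriv_deriv_trigEval_time, Nat.add_sub_cancel_left,
        show n + 1 - (1 + k) = n - k by omega]
    rw [hsum, Nat.add_sub_cancel]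
    refine mul_left_cancel₀ hsin ?_
    rw [mul_add, mul_inv_cancel_left₀ hsin, mul_zero, ← h]
    ring
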